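/- Let b satisfy (H1) and (H2), and for ε ∈ (0,1] let E(t,s,ξ,ε) be the fundamental solution of D_t U = (A(ξ) + B_ε(t))U with A(ξ) = [[0,|ξ|],[|ξ|,0]], B_ε(t) = diag(0, i𝔡_ε(t)), 𝔡_ε = b_ε′/b_ε. Let E⁰(t,s,ξ) denote the fundamental solution of the limit system D_t U = (A(ξ) + diag(0, i b′(t)/b(t)))U, which is well defined separately on [0,1) and on (1,2], and let E⁰(1₋0, t₁, ξ) = lim_{t↑1} E⁰(t,t₁,ξ) and E⁰(t₂, 1₊0, ξ) = lim_{s↓1} E⁰(t₂,s,ξ) (these limits exist since b′/b is bounded on each side of 1). Then for every fixed t₁ < 1 < t₂ in [0,2] and every fixed ξ with |ξ| > N (N the zone constant), lim_{ε→0} E(t₂,t₁,ξ,ε) = E⁰(t₂, 1₊0, ξ) · diag(1, H) · E⁰(1₋0, t₁, ξ), where H = b(1₋0)/b(1₊0). -/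

import Mathlib

open MeasureTheory Set Topology Filter

noncomputable section

/-- The scaled family `f_ε(t) = ε⁻¹ f(ε⁻¹ t)`. -/
def scaled (f : ℝ → ℝ) (ε t : ℝ) : ℝ := ε⁻¹ * f (ε⁻¹ * t)

/-- The regularisation `b_ε = b * ψ_ε` (convolution with the scaled mollifier). -/
def reg (b ψ : ℝ → ℝ) (ε t : ℝ) : ℝ := ∫ s, b s * scaled ψ ε (t - s)

/-- The dissipation coefficient `𝔡_ε = b_ε′ / b_ε`. -/
def dCoef (b ψ : ℝ → ℝ) (ε t : ℝ) : ℝ := deriv (reg b ψ ε) t / reg b ψ ε t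

/-- A shape function `Φ` with support `[-K', K']`. -/
structure IsShape (K' : ℝ) (Φ : ℝ → ℝ) : Prop where
  posK : 0 < K'
  nonneg : ∀ t, 0 ≤ Φ t
  cont : Continuous Φ
  even : ∀ t, Φ (-t) = Φ t
  supp : tsupport Φ = Icc (-K') K'
  diff : ∀ t : ℝ, t ≠ 0 → DifferentiableAt ℝ Φ t
  sq_est : ∃ C > 0, (∀ t < 0, (Φ t) ^ 2 ≤ C * deriv Φ t) ∧
    (∀ t > 0, (Φ t) ^ 2 ≤ -(C * deriv Φ t))

/-- A mollifier `ψ` with support `[-K, K]`. -/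
structure IsMollifier (K : ℝ) (ψ : ℝ → ℝ) : Prop where
  posK : 0 < K
  smooth : ContDiff ℝ (⊤ : ℕ∞) ψ
  nonneg : ∀ t, 0 ≤ ψ t
  even : ∀ t, ψ (-t) = ψ t
  supp : tsupport ψ = Icc (-K) K
  integral_one : ∫ t, ψ t = 1

/-- Derivatives of `ψ` are dominated by powers of the shape function `Φ`. -/
def DerivDominated (ψ Φ : ℝ → ℝ) : Prop :=
  ∀ k : ℕ, ∃ C > 0, ∀ t, |iteratedDeriv k ψ t| ≤ C * (Φ t) ^ k

/-- The coefficient `b` satisfying (H1) and (H2): it is bounded below by `b₀ > 0`, coincides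
with smooth functions `bm` (with all derivatives bounded) on `(-∞,1)` and `bp` on `(1,∞)`,
and has a jump at `t = 1`; `b(1₋0) = bm 1` and `b(1₊0) = bp 1`. -/
structure IsCoeff (b₀ : ℝ) (b bm bp : ℝ → ℝ) : Prop where
  pos : 0 < b₀
  lower : ∀ t, b₀ ≤ b t
  smooth_m : ContDiff ℝ (⊤ : ℕ∞) bm
  smooth_p : ContDiff ℝ (⊤ : ℕ∞) bp
  bdd_m : ∀ k : ℕ, ∃ C, ∀ t, |iteratedDeriv k bm t| ≤ C
  bdd_p : ∀ k : ℕ, ∃ C, ∀ t, |iteratedDeriv k bp t| ≤ C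
  eq_m : ∀ t < 1, b t = bm t
  eq_p : ∀ t > 1, b t = bp t
  jump : bp 1 ≠ bm 1

end

attribute [local instance] Matrix.frobeniusNormedAddCommGroup Matrix.frobeniusNormedSpace

noncomputable section

/-- The principal part `A(ξ) = [[0,|ξ|],[|ξ|,0]]`. -/
def Amat {n : ℕ} (ξ : EuclideanSpace ℝ (Fin n)) : Matrix (Fin 2) (Fin 2) ℂ :=
  !![0, (‖ξ‖ : ℂ); (‖ξ‖ : ℂ), 0]

/-- The dissipative part `B_ε(t) = diag(0, i𝔡_ε(t))`. -/
def Bmat (b ψ : ℝ → ℝ) (ε t : ℝ) : Matrix (Fin 2) (Fin 2) ℂ :=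
  !![0, 0; 0, Complex.I * (dCoef b ψ ε t : ℂ)]

/-- The dissipative part of the limit system, `diag(0, i b′(t)/b(t))`. -/
def Bmat0 (b : ℝ → ℝ) (t : ℝ) : Matrix (Fin 2) (Fin 2) ℂ :=
  !![0, 0; 0, Complex.I * ((deriv b t / b t : ℝ) : ℂ)]

end

/-! ### The regularised coefficient -/

lemma scaled_contDiff {K ε : ℝ} {ψ : ℝ → ℝ} (hψ : IsMollifier K ψ) :
    ContDiff ℝ 1 (scaled ψ ε) := by
  have h : ContDiff ℝ 1 ψ := hψ.smooth.of_le (by exact_mod_cast le_top)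
  exact contDiff_const.mul (h.comp (contDiff_const.mul contDiff_id))

lemma IsMollifier.hasCompactSupport {K : ℝ} {ψ : ℝ → ℝ} (hψ : IsMollifier K ψ) :
    HasCompactSupport ψ := by
  rw [HasCompactSupport, hψ.supp]
  exact isCompact_Icc

lemma IsMollifier.integrable {K : ℝ} {ψ : ℝ → ℝ} (hψ : IsMollifier K ψ) : Integrable ψ :=
  hψ.smooth.continuous.integrable_of_hasCompactSupport hψ.hasCompactSupport

lemma scaled_hasCompactSupport {K ε : ℝ} {ψ : ℝ → ℝ} (hψ : IsMollifier K ψ) (hε : 0 < ε) :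
    HasCompactSupport (scaled ψ ε) :=
  (hψ.hasCompactSupport.comp_homeomorph
    (Homeomorph.mulLeft₀ ε⁻¹ (inv_ne_zero hε.ne'))).mul_left

lemma IsCoeff.measurable {b₀ : ℝ} {b bm bp : ℝ → ℝ} (hb : IsCoeff b₀ b bm bp) :
    Measurable b := by
  have h : b = fun t => if t < 1 then bm t else if 1 < t then bp t else b 1 := by
    funext t
    rcases lt_trichotomy t 1 with h | h | h
    · simp [h, hb.eq_m t h]
    · simp [h]
    · simp [h, h.not_gt, hb.eq_p t h]
  rw [h]
  exact Measurable.ite measurableSet_Iio hb.smooth_m.continuous.measurable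
    (Measurable.ite measurableSet_Ioi hb.smooth_p.continuous.measurable measurable_const)

lemma IsCoeff.exists_bound {b₀ : ℝ} {b bm bp : ℝ → ℝ} (hb : IsCoeff b₀ b bm bp) :
    ∃ B, ∀ t, b t ≤ B := by
  obtain ⟨C₁, h₁⟩ := hb.bdd_m 0
  obtain ⟨C₂, h₂⟩ := hb.bdd_p 0
  simp only [iteratedDeriv_zero] at h₁ h₂
  refine ⟨max (max C₁ C₂) (b 1), fun t => ?_⟩
  rcases lt_trichotomy t 1 with h | h | h
  · exact le_max_of_le_left (le_max_of_le_left (hb.eq_m t h ▸ (le_abs_self _).trans (h₁ t)))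
  · exact h ▸ le_max_right _ _
  · exact le_max_of_le_left (le_max_of_le_right (hb.eq_p t h ▸ (le_abs_self _).trans (h₂ t)))

lemma IsCoeff.abs_le {b₀ B : ℝ} {b bm bp : ℝ → ℝ} (hb : IsCoeff b₀ b bm bp)
    (hB : ∀ t, b t ≤ B) (t : ℝ) : |b t| ≤ B := by
  rw [abs_of_pos (hb.pos.trans_le (hb.lower t))]
  exact hB t

lemma IsCoeff.lower_left {b₀ : ℝ} {b bm bp : ℝ → ℝ} (hb : IsCoeff b₀ b bm bp) {t : ℝ}
    (ht : t ≤ 1) : b₀ ≤ bm t := by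
  have h : closure (Iio (1 : ℝ)) ⊆ {t | b₀ ≤ bm t} :=
    closure_minimal (fun s hs => (hb.lower s).trans_eq (hb.eq_m s hs))
      (isClosed_le continuous_const hb.smooth_m.continuous)
  rw [closure_Iio] at h
  exact h ht

lemma IsCoeff.lower_right {b₀ : ℝ} {b bm bp : ℝ → ℝ} (hb : IsCoeff b₀ b bm bp) {t : ℝ}
    (ht : 1 ≤ t) : b₀ ≤ bp t := by
  have h : closure (Ioi (1 : ℝ)) ⊆ {t | b₀ ≤ bp t} :=
    closure_minimal (fun s hs => (hb.lower s).trans_eq (hb.eq_p s hs))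
      (isClosed_le continuous_const hb.smooth_p.continuous)
  rw [closure_Ioi] at h
  exact h ht

lemma IsCoeff.continuousAt {b₀ : ℝ} {b bm bp : ℝ → ℝ} (hb : IsCoeff b₀ b bm bp) {t : ℝ}
    (ht : t ≠ 1) : ContinuousAt b t := by
  rcases ht.lt_or_gt with h | h
  · exact hb.smooth_m.continuous.continuousAt.congr
      (eventually_of_mem (Iio_mem_nhds h) fun s hs => (hb.eq_m s hs).symm)
  · exact hb.smooth_p.continuous.continuousAt.congr
      (eventually_of_mem (Ioi_mem_nhds h) fun s hs => (hb.eq_p s hs).symm)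

lemma reg_differentiable {K b₀ ε : ℝ} {ψ b bm bp : ℝ → ℝ} (hψ : IsMollifier K ψ)
    (hb : IsCoeff b₀ b bm bp) (hε : 0 < ε) : Differentiable ℝ (reg b ψ ε) := by
  obtain ⟨B, hB⟩ := hb.exists_bound
  have hloc : LocallyIntegrable b volume :=
    (locallyIntegrable_const B).mono hb.measurable.aestronglyMeasurable
      (Eventually.of_forall fun t => (hb.abs_le hB t).trans (le_abs_self B))
  exact fun t => (HasCompactSupport.hasDerivAt_convolution_right (ContinuousLinearMap.mul ℝ ℝ)
    hloc (scaled_hasCompactSupport hψ hε) (scaled_contDiff hψ) t).differentiableAt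

lemma reg_eq {ψ b : ℝ → ℝ} {ε : ℝ} (hε : 0 < ε) (t : ℝ) :
    reg b ψ ε t = ∫ u, b (t - ε * u) * ψ u := by
  have h := Measure.integral_comp_mul_left (fun s => b (t - s) * scaled ψ ε s) ε
  rw [integral_sub_left_eq_self (fun s => b (t - s) * scaled ψ ε s) volume t |>.symm] at h
  simp only [sub_sub_cancel] at h
  have h' : ∀ u, b (t - ε * u) * scaled ψ ε (ε * u) = ε⁻¹ * (b (t - ε * u) * ψ u) := fun u => by
    rw [scaled, inv_mul_cancel_left₀ hε.ne']
    ring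
  simp only [h', integral_const_mul, abs_of_pos (inv_pos.2 hε), smul_eq_mul] at h
  exact (mul_left_cancel₀ (inv_ne_zero hε.ne') h).symm

lemma mollified_integrable {K b₀ : ℝ} {ψ b bm bp : ℝ → ℝ} (hψ : IsMollifier K ψ)
    (hb : IsCoeff b₀ b bm bp) (ε t : ℝ) : Integrable fun u => b (t - ε * u) * ψ u := by
  obtain ⟨B, hB⟩ := hb.exists_bound
  refine hψ.integrable.bdd_mul (c := B) ?_ (Eventually.of_forall fun u => hb.abs_le hB _)
  exact (hb.measurable.comp (by fun_prop)).aestronglyMeasurable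

lemma le_reg {K b₀ ε : ℝ} {ψ b bm bp : ℝ → ℝ} (hψ : IsMollifier K ψ)
    (hb : IsCoeff b₀ b bm bp) (hε : 0 < ε) (t : ℝ) : b₀ ≤ reg b ψ ε t := by
  rw [reg_eq hε]
  calc b₀ = ∫ u, b₀ * ψ u := by rw [integral_const_mul, hψ.integral_one, mul_one]
    _ ≤ _ := integral_mono (hψ.integrable.const_mul _) (mollified_integrable hψ hb ε t)
      fun u => mul_le_mul_of_nonneg_right (hb.lower _) (hψ.nonneg u)

lemma reg_le {K b₀ B ε : ℝ} {ψ b bm bp : ℝ → ℝ} (hψ : IsMollifier K ψ)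
    (hb : IsCoeff b₀ b bm bp) (hB : ∀ t, b t ≤ B) (hε : 0 < ε) (t : ℝ) : reg b ψ ε t ≤ B := by
  rw [reg_eq hε]
  calc _ ≤ ∫ u, B * ψ u := integral_mono (mollified_integrable hψ hb ε t)
        (hψ.integrable.const_mul _) fun u => mul_le_mul_of_nonneg_right (hB _) (hψ.nonneg u)
    _ = B := by rw [integral_const_mul, hψ.integral_one, mul_one]

lemma tendsto_reg {K b₀ : ℝ} {ψ b bm bp : ℝ → ℝ} (hψ : IsMollifier K ψ)
    (hb : IsCoeff b₀ b bm bp) {t : ℝ} (ht : t ≠ 1) :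
    Tendsto (fun ε => reg b ψ ε t) (𝓝[>] 0) (𝓝 (b t)) := by
  obtain ⟨B, hB⟩ := hb.exists_bound
  have key : Tendsto (fun ε : ℝ => ∫ u, b (t - ε * u) * ψ u) (𝓝[>] 0)
      (𝓝 (∫ u, b t * ψ u)) := by
    refine tendsto_integral_filter_of_dominated_convergence (fun u => B * ψ u)
      (Eventually.of_forall fun ε => (mollified_integrable hψ hb ε t).aestronglyMeasurable)
      (Eventually.of_forall fun ε => Eventually.of_forall fun u => ?_)
      (hψ.integrable.const_mul _) (Eventually.of_forall fun u => ?_)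
    · rw [norm_mul, Real.norm_eq_abs, Real.norm_of_nonneg (hψ.nonneg u)]
      exact mul_le_mul_of_nonneg_right (hb.abs_le hB _) (hψ.nonneg u)
    · refine Tendsto.mul_const _ ((hb.continuousAt ht).tendsto.comp ?_)
      refine tendsto_nhdsWithin_of_tendsto_nhds ?_
      have : Continuous fun ε : ℝ => t - ε * u := by fun_prop
      simpa using this.tendsto 0
  rw [integral_const_mul, hψ.integral_one, mul_one] at key
  exact key.congr' (eventually_mem_nhdsWithin.mono fun ε hε => (reg_eq hε t).symm)

/-! ### Wronskians of solutions in the conservative variables -/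

/-- The pair `(u, v)` solves `u′ = κ v / β`, `v′ = κ β u` on `(a, b)` and is continuous up to
the end points. -/
structure IsSolPair (κ : ℂ) (β : ℝ → ℝ) (a b : ℝ) (u v : ℝ → ℂ) : Prop where
  cont_fst : ContinuousOn u (Icc a b)
  cont_snd : ContinuousOn v (Icc a b)
  deriv_fst : ∀ t ∈ Ioo a b, HasDerivAt u (κ * (v t / β t)) t
  deriv_snd : ∀ t ∈ Ioo a b, HasDerivAt v (κ * (β t * u t)) t

/-- The integrand in the variation of the Wronskian of two solutions. -/
noncomputable def wronskianRate (κ : ℂ) (α β : ℝ → ℝ) (u v p r : ℝ → ℂ) (t : ℝ) : ℂ :=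
  κ * (((β t : ℂ)⁻¹ - (α t : ℂ)⁻¹) * (r t * v t) + ((α t : ℂ) - β t) * (p t * u t))

section Wronskian

variable {κ : ℂ} {α β : ℝ → ℝ} {a b : ℝ} {u v p r : ℝ → ℂ}

lemma ofReal_comp_continuousOn {s : Set ℝ} (hα : ContinuousOn α s) :
    ContinuousOn (fun t => (α t : ℂ)) s :=
  Complex.continuous_ofReal.comp_continuousOn hα

lemma continuousOn_wronskianRate (hα : ContinuousOn α (Icc a b)) (hβ : ContinuousOn β (Icc a b))
    (hα0 : ∀ t ∈ Icc a b, α t ≠ 0) (hβ0 : ∀ t ∈ Icc a b, β t ≠ 0)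
    (hu : IsSolPair κ α a b u v) (hp : IsSolPair κ β a b p r) :
    ContinuousOn (wronskianRate κ α β u v p r) (Icc a b) := by
  have h₁ := ofReal_comp_continuousOn hα
  have h₂ := ofReal_comp_continuousOn hβ
  have h₃ := h₁.inv₀ fun t ht => Complex.ofReal_ne_zero.2 (hα0 t ht)
  have h₄ := h₂.inv₀ fun t ht => Complex.ofReal_ne_zero.2 (hβ0 t ht)
  exact continuousOn_const.mul (((h₄.sub h₃).mul (hp.cont_snd.mul hu.cont_snd)).add
    ((h₁.sub h₂).mul (hp.cont_fst.mul hu.cont_fst)))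

lemma integral_wronskianRate (hab : a ≤ b) (hα : ContinuousOn α (Icc a b))
    (hβ : ContinuousOn β (Icc a b))
    (hα0 : ∀ t ∈ Icc a b, α t ≠ 0) (hβ0 : ∀ t ∈ Icc a b, β t ≠ 0)
    (hu : IsSolPair κ α a b u v) (hp : IsSolPair κ β a b p r) :
    ∫ t in a..b, wronskianRate κ α β u v p r t =
      (p b * v b - r b * u b) - (p a * v a - r a * u a) := by
  refine intervalIntegral.integral_eq_sub_of_hasDerivAt_of_le
    (f := fun t => p t * v t - r t * u t) hab
    ((hp.cont_fst.mul hu.cont_snd).sub (hp.cont_snd.mul hu.cont_fst)) (fun t ht => ?_) ?_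
  · refine (((hp.deriv_fst t ht).mul (hu.deriv_snd t ht)).sub
      ((hp.deriv_snd t ht).mul (hu.deriv_fst t ht))).congr_deriv ?_
    rw [wronskianRate]
    ring
  · exact ((continuousOn_wronskianRate hα hβ hα0 hβ0 hu hp).mono
      (uIcc_of_le hab).subset).intervalIntegrable

/-- The Wronskian of two solutions with the same coefficient is constant. -/
lemma wronskian_eq (hab : a ≤ b) (hβ : ContinuousOn β (Icc a b))
    (hβ0 : ∀ t ∈ Icc a b, β t ≠ 0)
    (hu : IsSolPair κ β a b u v) (hp : IsSolPair κ β a b p r) :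
    p b * v b - r b * u b = p a * v a - r a * u a := by
  have h := integral_wronskianRate hab hβ hβ hβ0 hβ0 hu hp
  simp only [wronskianRate, sub_self, zero_mul, add_zero, mul_zero,
    intervalIntegral.integral_zero] at h
  exact (sub_eq_zero.1 h.symm)

end Wronskian

/-- The Wronskian of a convergent family of solutions against a solution with the limit
coefficient is constant in the limit. -/
lemma tendsto_wronskian_sub {κ : ℂ} {β : ℝ → ℝ} {α : ℝ → ℝ → ℝ} {a b c B C : ℝ} {p r : ℝ → ℂ}
    {u v : ℝ → ℝ → ℂ} (hab : a ≤ b) (hc : 0 < c)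
    (hα : ∀ ε ∈ Ioc (0 : ℝ) 1, ContinuousOn (α ε) (Icc a b))
    (hαc : ∀ ε ∈ Ioc (0 : ℝ) 1, ∀ t ∈ Icc a b, c ≤ α ε t)
    (hαB : ∀ ε ∈ Ioc (0 : ℝ) 1, ∀ t ∈ Icc a b, α ε t ≤ B)
    (hβ : ContinuousOn β (Icc a b)) (hβc : ∀ t ∈ Icc a b, c ≤ β t)
    (hlim : ∀ t ∈ Ioo a b, Tendsto (fun ε => α ε t) (𝓝[>] 0) (𝓝 (β t)))
    (hu : ∀ ε ∈ Ioc (0 : ℝ) 1, IsSolPair κ (α ε) a b (u ε) (v ε))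
    (hC : ∀ ε ∈ Ioc (0 : ℝ) 1, ∀ t ∈ Icc a b, ‖u ε t‖ ≤ C ∧ ‖v ε t‖ ≤ C)
    (hp : IsSolPair κ β a b p r) :
    Tendsto (fun ε => (p b * v ε b - r b * u ε b) - (p a * v ε a - r a * u ε a))
      (𝓝[>] 0) (𝓝 0) := by
  have hpos : ∀ᶠ ε : ℝ in 𝓝[>] 0, ε ∈ Ioc (0 : ℝ) 1 := Ioc_mem_nhdsGT one_pos
  have hα0 : ∀ ε ∈ Ioc (0 : ℝ) 1, ∀ t ∈ Icc a b, α ε t ≠ 0 := fun ε hε t ht =>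
    (hc.trans_le (hαc ε hε t ht)).ne'
  have hβ0 : ∀ t ∈ Icc a b, β t ≠ 0 := fun t ht => (hc.trans_le (hβc t ht)).ne'
  obtain ⟨P, hP⟩ := isCompact_Icc.exists_bound_of_continuousOn hp.cont_fst
  obtain ⟨R, hR⟩ := isCompact_Icc.exists_bound_of_continuousOn hp.cont_snd
  obtain ⟨S, hS⟩ := isCompact_Icc.exists_bound_of_continuousOn hβ
  have hrate : ∀ ε ∈ Ioc (0 : ℝ) 1, ∀ t ∈ Icc a b,
      ‖wronskianRate κ (α ε) β (u ε) (v ε) p r t‖ ≤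
        ‖κ‖ * (‖(β t : ℂ)⁻¹ - (α ε t : ℂ)⁻¹‖ * (R * C) + ‖(α ε t : ℂ) - β t‖ * (P * C)) := by
    intro ε hε t ht
    have hR0 : 0 ≤ R := (norm_nonneg _).trans (hR t ht)
    have hP0 : 0 ≤ P := (norm_nonneg _).trans (hP t ht)
    rw [wronskianRate, norm_mul]
    refine mul_le_mul_of_nonneg_left ((norm_add_le _ _).trans ?_) (norm_nonneg _)
    simp only [norm_mul]
    have h₁ := mul_le_mul (hR t ht) (hC ε hε t ht).2 (norm_nonneg _) hR0
    have h₂ := mul_le_mul (hP t ht) (hC ε hε t ht).1 (norm_nonneg _) hP0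
    gcongr
  have key : Tendsto (fun ε => ∫ t in a..b, wronskianRate κ (α ε) β (u ε) (v ε) p r t)
      (𝓝[>] 0) (𝓝 (∫ _ in a..b, (0 : ℂ))) := by
    refine intervalIntegral.tendsto_integral_filter_of_dominated_convergence
      (fun _ => ‖κ‖ * ((c⁻¹ + c⁻¹) * (R * C) + (B + S) * (P * C))) ?_ ?_
      intervalIntegrable_const ?_
    · filter_upwards [hpos] with ε hε
      rw [uIoc_of_le hab]
      exact ((continuousOn_wronskianRate (hα ε hε) hβ (hα0 ε hε) hβ0 (hu ε hε) hp).mono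
        Ioc_subset_Icc_self).aestronglyMeasurable measurableSet_Ioc
    · filter_upwards [hpos] with ε hε
      refine Eventually.of_forall fun t ht => ?_
      rw [uIoc_of_le hab] at ht
      have ht' := Ioc_subset_Icc_self ht
      have hR0 : 0 ≤ R := (norm_nonneg _).trans (hR t ht')
      have hP0 : 0 ≤ P := (norm_nonneg _).trans (hP t ht')
      have hC0 : 0 ≤ C := (norm_nonneg _).trans (hC ε hε t ht').1
      refine (hrate ε hε t ht').trans ?_
      have hinv : ∀ x : ℝ, c ≤ x → ‖(x : ℂ)⁻¹‖ ≤ c⁻¹ := fun x hx => by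
        rw [norm_inv, Complex.norm_real, Real.norm_of_nonneg (hc.le.trans hx)]
        exact inv_anti₀ hc hx
      have h₁ : ‖(β t : ℂ)⁻¹ - (α ε t : ℂ)⁻¹‖ ≤ c⁻¹ + c⁻¹ :=
        (norm_sub_le _ _).trans (add_le_add (hinv _ (hβc t ht')) (hinv _ (hαc ε hε t ht')))
      have h₂ : ‖(α ε t : ℂ) - β t‖ ≤ B + S := by
        refine (norm_sub_le _ _).trans (add_le_add ?_ ?_)
        · rw [Complex.norm_real, Real.norm_of_nonneg (hc.le.trans (hαc ε hε t ht'))]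
          exact hαB ε hε t ht'
        · rw [Complex.norm_real]
          exact hS t ht'
      gcongr
    · filter_upwards [Measure.ae_ne volume b] with t htb ht
      rw [uIoc_of_le hab] at ht
      have ht' := Ioc_subset_Icc_self ht
      have hl := (Complex.continuous_ofReal.tendsto _).comp (hlim t ⟨ht.1, ht.2.lt_of_ne htb⟩)
      have hl' := hl.inv₀ (Complex.ofReal_ne_zero.2 (hβ0 t ht'))
      refine squeeze_zero_norm' (hpos.mono fun ε hε => hrate ε hε t ht') ?_
      have h₁ := ((tendsto_const_nhds (x := (β t : ℂ)⁻¹)).sub hl').norm.mul_const (R * C)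
      have h₂ := (hl.sub (tendsto_const_nhds (x := (β t : ℂ)))).norm.mul_const (P * C)
      simpa using (h₁.add h₂).const_mul ‖κ‖
  rw [intervalIntegral.integral_zero] at key
  refine key.congr' (hpos.mono fun ε hε => ?_)
  exact integral_wronskianRate hab (hα ε hε) hβ (hα0 ε hε) hβ0 (hu ε hε) hp

/-- Grönwall bound for solutions in the conservative variables. -/
lemma norm_solution_le {κ : ℂ} {α : ℝ → ℝ} {a b c B δ : ℝ} {u v : ℝ → ℂ} (hc : 0 < c)
    (hα : ∀ t ∈ Icc a b, c ≤ α t ∧ α t ≤ B)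
    (hu : ∀ t ∈ Icc a b, HasDerivWithinAt u (κ * (v t / α t)) (Icc a b) t)
    (hv : ∀ t ∈ Icc a b, HasDerivWithinAt v (κ * (α t * u t)) (Icc a b) t)
    (hδu : ‖u a‖ ≤ δ) (hδv : ‖v a‖ ≤ δ) :
    ∀ t ∈ Icc a b, ‖(u t, v t)‖ ≤ δ * Real.exp (‖κ‖ * max c⁻¹ B * (t - a)) := by
  have hd : ∀ t ∈ Icc a b, HasDerivWithinAt (fun t => (u t, v t))
      (κ * (v t / α t), κ * (α t * u t)) (Icc a b) t := fun t ht => (hu t ht).prodMk (hv t ht)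
  have := norm_le_gronwallBound_of_norm_deriv_right_le (f := fun t => (u t, v t))
    (f' := fun t => (κ * (v t / α t), κ * (α t * u t))) (a := a) (b := b) (δ := δ)
    (K := ‖κ‖ * max c⁻¹ B) (ε := 0)
    (fun t ht => (hd t ht).continuousWithinAt)
    (fun t ht => (hd t (Ico_subset_Icc_self ht)).mono_of_mem_nhdsWithin
      (Icc_mem_nhdsGE_of_mem ht)) (by simp [Prod.norm_def, hδu, hδv]) ?_
  · simpa only [gronwallBound_ε0] using this
  · intro t ht
    obtain ⟨h₁, h₂⟩ := hα t (Ico_subset_Icc_self ht)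
    have hpos : 0 < α t := hc.trans_le h₁
    rw [add_zero, mul_assoc, Prod.norm_def]
    simp only [norm_mul, norm_div, Complex.norm_real, Real.norm_of_nonneg hpos.le]
    refine max_le ?_ ?_
    · refine mul_le_mul_of_nonneg_left ?_ (norm_nonneg _)
      rw [div_eq_inv_mul]
      exact mul_le_mul ((inv_anti₀ hc h₁).trans (le_max_left _ _)) (norm_snd_le (u t, v t))
        (norm_nonneg _) (le_max_of_le_left (inv_pos.2 hc).le)
    · refine mul_le_mul_of_nonneg_left ?_ (norm_nonneg _)
      exact mul_le_mul (h₂.trans (le_max_right _ _)) (norm_fst_le (u t, v t))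
        (norm_nonneg _) (le_max_of_le_left (inv_pos.2 hc).le)

/-- A solution on `[a, b]` without the end point `e`, extended by its limits at `e`. -/
lemma isSolPair_update {κ : ℂ} {β : ℝ → ℝ} {a b e : ℝ} {u v : ℝ → ℂ} {U V : ℂ}
    (he : e ∉ Ioo a b)
    (hu : ∀ t ∈ Icc a b \ {e}, HasDerivAt u (κ * (v t / β t)) t)
    (hv : ∀ t ∈ Icc a b \ {e}, HasDerivAt v (κ * (β t * u t)) t)
    (hU : Tendsto u (𝓝[Icc a b \ {e}] e) (𝓝 U)) (hV : Tendsto v (𝓝[Icc a b \ {e}] e) (𝓝 V)) :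
    IsSolPair κ β a b (Function.update u e U) (Function.update v e V) := by
  have hmem : ∀ t ∈ Ioo a b, t ∈ Icc a b \ {e} := fun t ht =>
    ⟨Ioo_subset_Icc_self ht, fun h => he (h ▸ ht)⟩
  have hne : ∀ t ∈ Ioo a b, t ≠ e := fun t ht => (hmem t ht).2
  have hev : ∀ t ∈ Ioo a b, ∀ (f : ℝ → ℂ) (F : ℂ), Function.update f e F =ᶠ[𝓝 t] f :=
    fun t ht f F => (eventually_ne_nhds (hne t ht)).mono fun s hs => Function.update_of_ne hs _ _
  refine ⟨?_, ?_, fun t ht => ?_, fun t ht => ?_⟩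
  · exact continuousOn_update_iff.2
      ⟨fun t ht => (hu t ht).continuousAt.continuousWithinAt, fun _ => hU⟩
  · exact continuousOn_update_iff.2
      ⟨fun t ht => (hv t ht).continuousAt.continuousWithinAt, fun _ => hV⟩
  · rw [Function.update_of_ne (hne t ht)]
    exact (hu t (hmem t ht)).congr_of_eventuallyEq (hev t ht _ _)
  · rw [Function.update_of_ne (hne t ht)]
    exact (hv t (hmem t ht)).congr_of_eventuallyEq (hev t ht _ _)

/-! ### From the matrix systems to the conservative variables -/

lemma HasDerivWithinAt.matrix_apply {F : ℝ → Matrix (Fin 2) (Fin 2) ℂ}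
    {F' : Matrix (Fin 2) (Fin 2) ℂ} {s : Set ℝ} {t : ℝ} (h : HasDerivWithinAt F F' s t)
    (i j : Fin 2) : HasDerivWithinAt (fun u => F u i j) (F' i j) s t :=
  (LinearMap.toContinuousLinearMap
    (Matrix.entryLinearMap ℝ ℂ i j)).hasFDerivAt.comp_hasDerivWithinAt t h

lemma hasDerivWithinAt_conservative {n : ℕ} {ξ : EuclideanSpace ℝ (Fin n)} {β : ℝ → ℝ}
    {β' t : ℝ} {s : Set ℝ} {F : ℝ → Matrix (Fin 2) (Fin 2) ℂ} (hβ : HasDerivWithinAt β β' s t)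
    (hβ0 : β t ≠ 0)
    (hF : HasDerivWithinAt F (Complex.I • ((Amat ξ +
      !![0, 0; 0, Complex.I * ((β' / β t : ℝ) : ℂ)]) * F t)) s t) (j : Fin 2) :
    HasDerivWithinAt (fun τ => F τ 0 j) (Complex.I * ‖ξ‖ * ((β t : ℂ) * F t 1 j / β t)) s t ∧
    HasDerivWithinAt (fun τ => (β τ : ℂ) * F τ 1 j) (Complex.I * ‖ξ‖ * (β t * F t 0 j)) s t := by
  have hβ0' : (β t : ℂ) ≠ 0 := Complex.ofReal_ne_zero.2 hβ0
  have hI := Complex.I_mul_I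
  constructor
  · refine (hF.matrix_apply 0 j).congr_deriv ?_
    simp [Amat, Matrix.vecMul, dotProduct, Fin.sum_univ_two]
    field_simp
  · refine (hβ.ofReal_comp.mul (hF.matrix_apply 1 j)).congr_deriv ?_
    simp [Amat, Matrix.vecMul, dotProduct, Fin.sum_univ_two]
    field_simp
    linear_combination (β' * F t 1 j : ℂ) * hI

/-- Backward and forward fundamental solutions are related by the adjugate: if the columns of
`G` start at `s` from the unit vectors and those of `P` start at `t`, then
`β s • P s = β t • adj (G t)`. -/
lemma backward_eq_adjugate {κ : ℂ} {β : ℝ → ℝ} {s t : ℝ} {G P : ℝ → Matrix (Fin 2) (Fin 2) ℂ}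
    (hst : s ≤ t) (hβ : ContinuousOn β (Icc s t)) (hβ0 : ∀ τ ∈ Icc s t, β τ ≠ 0)
    (hG : ∀ j, IsSolPair κ β s t (fun τ => G τ 0 j) (fun τ => β τ * G τ 1 j))
    (hP : ∀ j, IsSolPair κ β s t (fun τ => P τ 0 j) (fun τ => β τ * P τ 1 j))
    (hGs : G s = 1) (hPt : P t = 1) :
    β s * P s 0 0 = β t * G t 1 1 ∧ β s * P s 0 1 = -(β t * G t 0 1) ∧
      β s * P s 1 0 = -(β t * G t 1 0) ∧ β s * P s 1 1 = β t * G t 0 0 := by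
  have h := fun i k => wronskian_eq hst hβ hβ0 (hG i) (hP k)
  have h₀₀ := h 0 0
  have h₀₁ := h 0 1
  have h₁₀ := h 1 0
  have h₁₁ := h 1 1
  simp [hGs, hPt] at h₀₀ h₀₁ h₁₀ h₁₁
  refine ⟨?_, ?_, ?_, ?_⟩
  · linear_combination -h₁₀
  · linear_combination -h₁₁
  · linear_combination h₀₀
  · linear_combination -h₀₁

/-- Recover the limit of a vector from the limits of its Wronskians with a basis. -/
lemma tendsto_of_wronskians {l : Filter ℝ} {u v : ℝ → ℂ} {p₀ r₀ p₁ r₁ l₀ l₁ d : ℂ}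
    (hd : p₀ * r₁ - r₀ * p₁ = d) (hd0 : d ≠ 0)
    (h₀ : Tendsto (fun ε => p₀ * v ε - r₀ * u ε) l (𝓝 l₀))
    (h₁ : Tendsto (fun ε => p₁ * v ε - r₁ * u ε) l (𝓝 l₁)) :
    Tendsto u l (𝓝 ((p₁ * l₀ - p₀ * l₁) / d)) ∧ Tendsto v l (𝓝 ((r₁ * l₀ - r₀ * l₁) / d)) := by
  constructor
  · refine (((h₀.const_mul p₁).sub (h₁.const_mul p₀)).div_const d).congr fun ε => ?_
    rw [div_eq_iff hd0, ← hd]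
    ring
  · refine (((h₀.const_mul r₁).sub (h₁.const_mul r₀)).div_const d).congr fun ε => ?_
    rw [div_eq_iff hd0, ← hd]
    ring

lemma IsCoeff.eventuallyEq_left {b₀ : ℝ} {b bm bp : ℝ → ℝ} (hb : IsCoeff b₀ b bm bp) {t : ℝ}
    (ht : t < 1) : b =ᶠ[𝓝 t] bm :=
  eventually_of_mem (Iio_mem_nhds ht) hb.eq_m

lemma IsCoeff.eventuallyEq_right {b₀ : ℝ} {b bm bp : ℝ → ℝ} (hb : IsCoeff b₀ b bm bp) {t : ℝ}
    (ht : 1 < t) : b =ᶠ[𝓝 t] bp :=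
  eventually_of_mem (Ioi_mem_nhds ht) hb.eq_p

lemma hasDerivAt_conservative_limit {n : ℕ} {ξ : EuclideanSpace ℝ (Fin n)} {b β : ℝ → ℝ}
    {t : ℝ} {F : ℝ → Matrix (Fin 2) (Fin 2) ℂ} (hbβ : b =ᶠ[𝓝 t] β)
    (hβ : DifferentiableAt ℝ β t) (hβ0 : β t ≠ 0)
    (hF : HasDerivAt F (Complex.I • ((Amat ξ + Bmat0 b t) * F t)) t) (j : Fin 2) :
    HasDerivAt (fun τ => F τ 0 j) (Complex.I * ‖ξ‖ * ((β t : ℂ) * F t 1 j / β t)) t ∧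
    HasDerivAt (fun τ => (β τ : ℂ) * F τ 1 j) (Complex.I * ‖ξ‖ * (β t * F t 0 j)) t := by
  rw [Bmat0, hbβ.deriv_eq, hbβ.eq_of_nhds] at hF
  have h := hasDerivWithinAt_conservative (s := univ) hβ.hasDerivAt.hasDerivWithinAt hβ0
    hF.hasDerivWithinAt j
  exact ⟨hasDerivWithinAt_univ.1 h.1, hasDerivWithinAt_univ.1 h.2⟩

lemma tendsto_matrix_apply {l : Filter ℝ} {F : ℝ → Matrix (Fin 2) (Fin 2) ℂ}
    {L : Matrix (Fin 2) (Fin 2) ℂ} (h : Tendsto F l (𝓝 L)) (i j : Fin 2) :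
    Tendsto (fun t => F t i j) l (𝓝 (L i j)) :=
  ((continuous_id.matrix_elem i j).tendsto L).comp h

/-- formula (4.114), interaction with the singularity.  Let `E` be the
fundamental solution of the regularised system and `E⁰` the fundamental solution of the
limit system on either side of `t = 1`, with one-sided limits `E⁰(1₋0,t₁,ξ) = Elm` and
`E⁰(t₂,1₊0,ξ) = Erp`.  Then for fixed `t₁ < 1 < t₂` and `|ξ| > N` (`N` the zone constant),
`lim_{ε→0} E(t₂,t₁,ξ,ε) = E⁰(t₂,1₊0,ξ)·diag(1,H)·E⁰(1₋0,t₁,ξ)` with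
`H = b(1₋0)/b(1₊0)`. -/
theorem stmt19 {n : ℕ} (K K' b₀ : ℝ) (Φ ψ b bm bp : ℝ → ℝ)
    (hΦ : IsShape K' Φ) (hψ : IsMollifier K ψ) (hKK' : K ≤ K')
    (hdom : DerivDominated ψ Φ) (hb : IsCoeff b₀ b bm bp)
    (E : ℝ → ℝ → EuclideanSpace ℝ (Fin n) → ℝ → Matrix (Fin 2) (Fin 2) ℂ)
    (hEinit : ∀ s ∈ Icc (0:ℝ) 2, ∀ (ξ : EuclideanSpace ℝ (Fin n)), ∀ ε ∈ Ioc (0:ℝ) 1,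
      E s s ξ ε = 1)
    (hEode : ∀ s ∈ Icc (0:ℝ) 2, ∀ (ξ : EuclideanSpace ℝ (Fin n)), ∀ ε ∈ Ioc (0:ℝ) 1,
      ∀ t ∈ Icc (0:ℝ) 2,
      HasDerivWithinAt (fun u => E u s ξ ε)
        (Complex.I • ((Amat ξ + Bmat b ψ ε t) * E t s ξ ε)) (Icc (0:ℝ) 2) t)
    (E0 : ℝ → ℝ → EuclideanSpace ℝ (Fin n) → Matrix (Fin 2) (Fin 2) ℂ)
    (hE0init : ∀ s ∈ Icc (0:ℝ) 2, ∀ ξ : EuclideanSpace ℝ (Fin n), E0 s s ξ = 1)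
    (hE0ode : ∀ s t : ℝ, ∀ ξ : EuclideanSpace ℝ (Fin n),
      s ∈ Icc (0:ℝ) 2 → t ∈ Icc (0:ℝ) 2 → ((s < 1 ∧ t < 1) ∨ (1 < s ∧ 1 < t)) →
      HasDerivAt (fun u => E0 u s ξ)
        (Complex.I • ((Amat ξ + Bmat0 b t) * E0 t s ξ)) t) :
    ∃ N > 0, ∀ t₁ ∈ Icc (0:ℝ) 2, ∀ t₂ ∈ Icc (0:ℝ) 2, t₁ < 1 → 1 < t₂ →
      ∀ ξ : EuclideanSpace ℝ (Fin n), N < ‖ξ‖ →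
      ∀ Elm Erp : Matrix (Fin 2) (Fin 2) ℂ,
        Filter.Tendsto (fun t => E0 t t₁ ξ) (𝓝[<] 1) (𝓝 Elm) →
        Filter.Tendsto (fun s => E0 t₂ s ξ) (𝓝[>] 1) (𝓝 Erp) →
        Filter.Tendsto (fun ε => E t₂ t₁ ξ ε) (𝓝[>] 0)
          (𝓝 (Erp * !![1, 0; 0, ((bm 1 / bp 1 : ℝ) : ℂ)] * Elm)) := by
  obtain ⟨B, hB⟩ := hb.exists_bound
  refine ⟨1, one_pos, fun t₁ ht₁ t₂ ht₂ h₁ h₂ ξ _ Elm Erp hElm hErp => ?_⟩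
  have hpos : ∀ᶠ ε : ℝ in 𝓝[>] 0, ε ∈ Ioc (0 : ℝ) 1 := Ioc_mem_nhdsGT one_pos
  have hlow : ∀ ε ∈ Ioc (0 : ℝ) 1, ∀ t, b₀ ≤ reg b ψ ε t := fun ε hε => le_reg hψ hb hε.1
  have hupp : ∀ ε ∈ Ioc (0 : ℝ) 1, ∀ t, reg b ψ ε t ≤ B := fun ε hε => reg_le hψ hb hB hε.1
  have hdiff : ∀ ε ∈ Ioc (0 : ℝ) 1, Differentiable ℝ (reg b ψ ε) := fun ε hε =>
    reg_differentiable hψ hb hε.1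
  have hbm0 : ∀ t ≤ 1, bm t ≠ 0 := fun t ht => (hb.pos.trans_le (hb.lower_left ht)).ne'
  have hbp0 : ∀ t, 1 ≤ t → bp t ≠ 0 := fun t ht => (hb.pos.trans_le (hb.lower_right ht)).ne'
  have hbp0' : (bp 1 : ℂ) ≠ 0 := Complex.ofReal_ne_zero.2 (hbp0 1 le_rfl)
  have hbm₁ : (bm t₁ : ℂ) ≠ 0 := Complex.ofReal_ne_zero.2 (hbm0 t₁ h₁.le)
  have hbp₂ : (bp t₂ : ℂ) ≠ 0 := Complex.ofReal_ne_zero.2 (hbp0 t₂ h₂.le)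
  -- the regularised family in conservative variables
  have hE : ∀ j, ∀ ε ∈ Ioc (0 : ℝ) 1, ∀ t ∈ Icc (0 : ℝ) 2, _ := fun j ε hε t ht =>
    hasDerivWithinAt_conservative (hdiff ε hε t).hasDerivAt.hasDerivWithinAt
      (hb.pos.trans_le (hlow ε hε t)).ne' (hEode t₁ ht₁ ξ ε hε t ht) j
  have hEsol : ∀ a c, 0 ≤ a → c ≤ 2 → ∀ j, ∀ ε ∈ Ioc (0 : ℝ) 1,
      IsSolPair (Complex.I * ‖ξ‖) (reg b ψ ε) a c (fun t => E t t₁ ξ ε 0 j)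
        (fun t => reg b ψ ε t * E t t₁ ξ ε 1 j) := by
    intro a c ha hc j ε hε
    have hsub : Icc a c ⊆ Icc 0 2 := Icc_subset_Icc ha hc
    have hnhds : ∀ t ∈ Ioo a c, Icc (0 : ℝ) 2 ∈ 𝓝 t := fun t ht =>
      mem_of_superset (Icc_mem_nhds ht.1 ht.2) hsub
    exact ⟨fun t ht => ((hE j ε hε t (hsub ht)).1.mono hsub).continuousWithinAt,
      fun t ht => ((hE j ε hε t (hsub ht)).2.mono hsub).continuousWithinAt,
      fun t ht => (hE j ε hε t (hsub (Ioo_subset_Icc_self ht))).1.hasDerivAt (hnhds t ht),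
      fun t ht => (hE j ε hε t (hsub (Ioo_subset_Icc_self ht))).2.hasDerivAt (hnhds t ht)⟩
  obtain ⟨C, hC⟩ : ∃ C, ∀ j, ∀ ε ∈ Ioc (0 : ℝ) 1, ∀ t ∈ Icc t₁ t₂,
      ‖E t t₁ ξ ε 0 j‖ ≤ C ∧ ‖(reg b ψ ε t : ℂ) * E t t₁ ξ ε 1 j‖ ≤ C := by
    refine ⟨max 1 B * Real.exp (‖Complex.I * (‖ξ‖ : ℂ)‖ * max b₀⁻¹ B * (t₂ - t₁)),
      fun j ε hε t ht => ?_⟩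
    have hsub : Icc t₁ t₂ ⊆ Icc 0 2 := Icc_subset_Icc ht₁.1 ht₂.2
    have hone : ∀ i, ‖(1 : Matrix (Fin 2) (Fin 2) ℂ) i j‖ ≤ 1 := fun i => by
      rw [Matrix.one_apply]
      split_ifs <;> simp
    have hle := norm_solution_le (δ := max 1 B) hb.pos (fun t _ => ⟨hlow ε hε t, hupp ε hε t⟩)
      (fun t ht => (hE j ε hε t (hsub ht)).1.mono hsub)
      (fun t ht => (hE j ε hε t (hsub ht)).2.mono hsub)
      (by rw [hEinit t₁ ht₁ ξ ε hε]; exact (hone 0).trans (le_max_left _ _))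
      (by
        rw [hEinit t₁ ht₁ ξ ε hε, norm_mul, Complex.norm_real,
          Real.norm_of_nonneg (hb.pos.le.trans (hlow ε hε t₁))]
        exact (mul_le_of_le_one_right (hb.pos.le.trans (hlow ε hε t₁)) (hone 1)).trans
          ((hupp ε hε t₁).trans (le_max_right _ _))) t ht
    have hexp : max 1 B * Real.exp (‖Complex.I * (‖ξ‖ : ℂ)‖ * max b₀⁻¹ B * (t - t₁)) ≤
        max 1 B * Real.exp (‖Complex.I * (‖ξ‖ : ℂ)‖ * max b₀⁻¹ B * (t₂ - t₁)) := by
      have hM : 0 ≤ max b₀⁻¹ B := le_max_of_le_left (inv_pos.2 hb.pos).le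
      have := ht.2
      gcongr
    exact ⟨(norm_fst_le _).trans (hle.trans hexp), (norm_snd_le _).trans (hle.trans hexp)⟩
  -- the limit system on either side
  have hm : ∀ t ∈ Icc t₁ 1 \ {1}, ∀ k, _ := fun t ht k =>
    have hlt : t < 1 := ht.1.2.lt_of_ne ht.2
    hasDerivAt_conservative_limit (hb.eventuallyEq_left hlt)
      (hb.smooth_m.differentiable (by simp) t) (hbm0 t hlt.le)
      (hE0ode t₁ t ξ ht₁ ⟨ht₁.1.trans ht.1.1, ht.1.2.trans one_le_two⟩ (.inl ⟨h₁, hlt⟩)) k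
  have hp : ∀ s : ℝ, 1 < s → s ≤ 2 → ∀ t : ℝ, 1 < t → t ≤ 2 → ∀ k, _ := fun s hs hs' t ht ht' k =>
    hasDerivAt_conservative_limit (hb.eventuallyEq_right ht)
      (hb.smooth_p.differentiable (by simp) t) (hbp0 t ht.le)
      (hE0ode s t ξ ⟨by linarith, hs'⟩ ⟨by linarith, ht'⟩ (.inr ⟨hs, ht⟩)) k
  have hbm_lim : Tendsto (fun t => (bm t : ℂ)) (𝓝[<] 1) (𝓝 (bm 1)) :=
    ((Complex.continuous_ofReal.comp hb.smooth_m.continuous).tendsto 1).mono_left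
      nhdsWithin_le_nhds
  have hbp_lim : Tendsto (fun t => (bp t : ℂ)) (𝓝[>] 1) (𝓝 (bp 1)) :=
    ((Complex.continuous_ofReal.comp hb.smooth_p.continuous).tendsto 1).mono_left
      nhdsWithin_le_nhds
  have hleft : 𝓝[Icc t₁ 1 \ {1}] (1 : ℝ) ≤ 𝓝[<] 1 :=
    nhdsWithin_mono _ fun t ht => ht.1.2.lt_of_ne ht.2
  have hright : 𝓝[Icc 1 t₂ \ {1}] (1 : ℝ) ≤ 𝓝[>] 1 :=
    nhdsWithin_mono _ fun t ht => ht.1.1.lt_of_ne' ht.2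
  have hmsol : ∀ k, IsSolPair (Complex.I * ‖ξ‖) bm t₁ 1
      (Function.update (fun t => E0 t t₁ ξ 0 k) 1 (Elm 0 k))
      (Function.update (fun t => bm t * E0 t t₁ ξ 1 k) 1 (bm 1 * Elm 1 k)) := fun k =>
    isSolPair_update (fun h => lt_irrefl _ h.2) (fun t ht => (hm t ht k).1)
      (fun t ht => (hm t ht k).2) ((tendsto_matrix_apply hElm 0 k).mono_left hleft)
      ((hbm_lim.mul (tendsto_matrix_apply hElm 1 k)).mono_left hleft)
  have hdet : Elm 0 0 * (bm 1 * Elm 1 1) - bm 1 * Elm 1 0 * Elm 0 1 = bm t₁ := by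
    have h := wronskian_eq h₁.le hb.smooth_m.continuous.continuousOn
      (fun t ht => hbm0 t ht.2) (hmsol 1) (hmsol 0)
    simpa [h₁.ne, hE0init t₁ ht₁ ξ] using h
  have hreg₁ : Tendsto (fun ε => (reg b ψ ε t₁ : ℂ)) (𝓝[>] 0) (𝓝 (bm t₁)) := by
    rw [← hb.eq_m t₁ h₁]
    exact (Complex.continuous_ofReal.tendsto _).comp (tendsto_reg hψ hb h₁.ne)
  have hreg₂ : Tendsto (fun ε => (reg b ψ ε t₂ : ℂ)) (𝓝[>] 0) (𝓝 (bp t₂)) := by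
    rw [← hb.eq_p t₂ h₂]
    exact (Complex.continuous_ofReal.tendsto _).comp (tendsto_reg hψ hb h₂.ne')
  have hmid : ∀ j, Tendsto (fun ε => E 1 t₁ ξ ε 0 j) (𝓝[>] 0) (𝓝 (Elm 0 j)) ∧
      Tendsto (fun ε => (reg b ψ ε 1 : ℂ) * E 1 t₁ ξ ε 1 j) (𝓝[>] 0) (𝓝 (bm 1 * Elm 1 j)) := by
    intro j
    have hW := fun k => tendsto_wronskian_sub h₁.le hb.pos
      (fun ε hε => (hdiff ε hε).continuous.continuousOn) (fun ε hε t _ => hlow ε hε t)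
      (fun ε hε t _ => hupp ε hε t) hb.smooth_m.continuous.continuousOn
      (fun t ht => hb.lower_left ht.2)
      (fun t ht => hb.eq_m t ht.2 ▸ tendsto_reg hψ hb ht.2.ne)
      (hEsol t₁ 1 ht₁.1 one_le_two j)
      (fun ε hε t ht => hC j ε hε t ⟨ht.1, ht.2.trans h₂.le⟩) (hmsol k)
    simp only [Function.update_self, Function.update_of_ne h₁.ne, hE0init t₁ ht₁ ξ] at hW
    have hstart : ∀ k, Tendsto (fun ε => (1 : Matrix (Fin 2) (Fin 2) ℂ) 0 k *
        (reg b ψ ε t₁ * E t₁ t₁ ξ ε 1 j) -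
        bm t₁ * (1 : Matrix (Fin 2) (Fin 2) ℂ) 1 k * E t₁ t₁ ξ ε 0 j) (𝓝[>] 0)
        (𝓝 ((1 : Matrix (Fin 2) (Fin 2) ℂ) 0 k *
        (bm t₁ * (1 : Matrix (Fin 2) (Fin 2) ℂ) 1 j) -
        bm t₁ * (1 : Matrix (Fin 2) (Fin 2) ℂ) 1 k * (1 : Matrix (Fin 2) (Fin 2) ℂ) 0 j)) := by
      intro k
      refine (((hreg₁.mul_const _).const_mul _).sub_const _).congr'
        (hpos.mono fun ε hε => ?_)
      simp only [hEinit t₁ ht₁ ξ ε hε]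
    have hT := fun k => ((hW k).add (hstart k)).congr fun ε => sub_add_cancel _ _
    obtain ⟨hu, hv⟩ := tendsto_of_wronskians hdet hbm₁ (hT 0) (hT 1)
    refine ⟨?_, ?_⟩
    · convert hu using 2
      rw [eq_div_iff hbm₁]
      obtain rfl | rfl : j = 0 ∨ j = 1 := by omega
      all_goals simp
    · convert hv using 2
      rw [eq_div_iff hbm₁]
      obtain rfl | rfl : j = 0 ∨ j = 1 := by omega
      all_goals simp
  -- the backward fundamental solution right of the singularity
  have hback : ∀ s, 1 < s → s < t₂ →
      (bp s * E0 s t₂ ξ 0 0 = bp t₂ * E0 t₂ s ξ 1 1 ∧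
        bp s * E0 s t₂ ξ 0 1 = -(bp t₂ * E0 t₂ s ξ 0 1) ∧
        bp s * E0 s t₂ ξ 1 0 = -(bp t₂ * E0 t₂ s ξ 1 0) ∧
        bp s * E0 s t₂ ξ 1 1 = bp t₂ * E0 t₂ s ξ 0 0) := by
    intro s hs hst
    have hsol : ∀ r : ℝ, 1 < r → r ≤ 2 → ∀ k, IsSolPair (Complex.I * ‖ξ‖) bp s t₂
        (fun t => E0 t r ξ 0 k) (fun t => bp t * E0 t r ξ 1 k) := fun r hr hr' k =>
      have hd := fun t (ht : t ∈ Icc s t₂) =>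
        hp r hr hr' t (hs.trans_le ht.1) (ht.2.trans ht₂.2) k
      ⟨fun t ht => (hd t ht).1.continuousAt.continuousWithinAt,
        fun t ht => (hd t ht).2.continuousAt.continuousWithinAt,
        fun t ht => (hd t (Ioo_subset_Icc_self ht)).1,
        fun t ht => (hd t (Ioo_subset_Icc_self ht)).2⟩
    exact backward_eq_adjugate (G := fun t => E0 t s ξ) (P := fun t => E0 t t₂ ξ) hst.le
      hb.smooth_p.continuous.continuousOn
      (fun t ht => hbp0 t (hs.le.trans ht.1)) (hsol s hs (hst.le.trans ht₂.2))
      (hsol t₂ h₂ ht₂.2) (hE0init s ⟨by linarith, hst.le.trans ht₂.2⟩ ξ) (hE0init t₂ ht₂ ξ)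
  have hnear : ∀ᶠ s : ℝ in 𝓝[>] 1, 1 < s ∧ s < t₂ := Ioo_mem_nhdsGT h₂
  have hErp' := fun i k => (tendsto_matrix_apply hErp i k).const_mul (bp t₂ : ℂ)
  have hdivlim : ∀ {f g : ℝ → ℂ} {L : ℂ}, (∀ s, 1 < s → s < t₂ → bp s * f s = g s) →
      Tendsto g (𝓝[>] 1) (𝓝 L) → Tendsto f (𝓝[>] 1) (𝓝 (L / bp 1)) := fun h hg =>
    (hg.div hbp_lim hbp0').congr' (hnear.mono fun s hs =>
      (div_eq_iff (Complex.ofReal_ne_zero.2 (hbp0 s hs.1.le))).2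
        ((h s hs.1 hs.2).symm.trans (mul_comm _ _)))
  have hpsol : ∀ {k} {U V : ℂ}, Tendsto (fun t => E0 t t₂ ξ 0 k) (𝓝[>] 1) (𝓝 U) →
      Tendsto (fun t => E0 t t₂ ξ 1 k) (𝓝[>] 1) (𝓝 V) →
      IsSolPair (Complex.I * ‖ξ‖) bp 1 t₂ (Function.update (fun t => E0 t t₂ ξ 0 k) 1 U)
        (Function.update (fun t => bp t * E0 t t₂ ξ 1 k) 1 (bp 1 * V)) := fun {k _ _} hU hV =>
    have hd := fun t (ht : t ∈ Icc 1 t₂ \ {1}) =>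
      hp t₂ h₂ ht₂.2 t (ht.1.1.lt_of_ne' ht.2) (ht.1.2.trans ht₂.2) k
    isSolPair_update (fun h => lt_irrefl _ h.1) (fun t ht => (hd t ht).1)
      (fun t ht => (hd t ht).2) (hU.mono_left hright) ((hbp_lim.mul hV).mono_left hright)
  have hp₀ := hpsol (hdivlim (fun s hs hst => (hback s hs hst).1) (hErp' 1 1))
    (hdivlim (fun s hs hst => (hback s hs hst).2.2.1) (hErp' 1 0).neg)
  have hp₁ := hpsol (hdivlim (fun s hs hst => (hback s hs hst).2.1) (hErp' 0 1).neg)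
    (hdivlim (fun s hs hst => (hback s hs hst).2.2.2) (hErp' 0 0))
  have hend : ∀ j, Tendsto (fun ε => E t₂ t₁ ξ ε 0 j) (𝓝[>] 0)
      (𝓝 (Erp 0 0 * Elm 0 j + Erp 0 1 * (bm 1 / bp 1) * Elm 1 j)) ∧
      Tendsto (fun ε => E t₂ t₁ ξ ε 1 j) (𝓝[>] 0)
      (𝓝 (Erp 1 0 * Elm 0 j + Erp 1 1 * (bm 1 / bp 1) * Elm 1 j)) := by
    intro j
    have hW := fun {p r : ℝ → ℂ} (h : IsSolPair (Complex.I * ‖ξ‖) bp 1 t₂ p r) =>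
      tendsto_wronskian_sub h₂.le hb.pos
      (fun ε hε => (hdiff ε hε).continuous.continuousOn) (fun ε hε t _ => hlow ε hε t)
      (fun ε hε t _ => hupp ε hε t) hb.smooth_p.continuous.continuousOn
      (fun t ht => hb.lower_right ht.1)
      (fun t ht => hb.eq_p t ht.1 ▸ tendsto_reg hψ hb ht.1.ne')
      (hEsol 1 t₂ zero_le_one ht₂.2 j)
      (fun ε hε t ht => hC j ε hε t ⟨h₁.le.trans ht.1, ht.2⟩) h
    obtain ⟨hu, hv⟩ := hmid j
    have hT := fun {p r : ℝ → ℂ} (h : IsSolPair (Complex.I * ‖ξ‖) bp 1 t₂ p r) =>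
      ((hW h).add ((hv.const_mul (p 1)).sub (hu.const_mul (r 1)))).congr
        fun ε => sub_add_cancel _ _
    have hT₀ := hT hp₀
    have hT₁ := hT hp₁
    simp only [Function.update_self, Function.update_of_ne h₂.ne', hE0init t₂ ht₂ ξ,
      Matrix.one_apply_eq, ne_eq, zero_ne_one, one_ne_zero, not_false_eq_true,
      Matrix.one_apply_ne, one_mul, zero_mul, mul_zero, mul_one, sub_zero, zero_sub,
      zero_add] at hT₀ hT₁
    constructor
    · convert (hT₁.div_const (-(bp t₂ : ℂ))) using 2
      · field_simp
      · field_simp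
        ring
    · refine ((hT₀.div hreg₂ hbp₂).congr' (hpos.mono fun ε hε => ?_)).trans_eq ?_
      · exact mul_div_cancel_left₀ _
          (Complex.ofReal_ne_zero.2 (hb.pos.trans_le (hlow ε hε t₂)).ne')
      · congr 1
        field_simp
        ring
  refine tendsto_pi_nhds.2 fun i => tendsto_pi_nhds.2 fun j => ?_
  obtain rfl | rfl : i = 0 ∨ i = 1 := by omega
  · convert (hend j).1 using 2
    simp [Matrix.mul_apply, Fin.sum_univ_two]
  · convert (hend j).2 using 2
    simp [Matrix.mul_apply, Fin.sum_univ_two]
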